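/- Additivity of finite type for decoupled defining functions: let ρ : U → ℝ (U ⊂ ℂ^n, 0 ∈ ∂G = {ρ=0}) be smooth with ∇ρ ≠ 0 such that the restriction of i∂∂̄ρ to the complex tangent space of ∂G is nonnegative and ∂G is of finite type τ at 0, and let h : V → ℝ₊ (V ⊂ ℂ^m a neighborhood of 0) be smooth with h(w)=0 ⟺ w=0, ∇h(w)≠0 for w≠0, and h of finite type typ₀(h) at the origin. Then ∂G̃ = {(z,w) : ρ(z)+h(w) = 0} is of finite type max(τ, typ₀(h)) at (0,0). -/

import Mathlib

/-- Wirtinger derivative ∂f/∂z_j. -/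
noncomputable def wd {d : ℕ} (j : Fin d) (f : (Fin d → ℂ) → ℂ) (z : Fin d → ℂ) : ℂ :=
  (fderiv ℝ f z (Pi.single j 1) - Complex.I * fderiv ℝ f z (Pi.single j Complex.I)) / 2

/-- Wirtinger derivative ∂f/∂z̄_j. -/
noncomputable def wdbar {d : ℕ} (j : Fin d) (f : (Fin d → ℂ) → ℂ) (z : Fin d → ℂ) : ℂ :=
  (fderiv ℝ f z (Pi.single j 1) + Complex.I * fderiv ℝ f z (Pi.single j Complex.I)) / 2

/-- The complex Hessian (Levi) form ∑_{j,k} ∂²f/∂z_j∂z̄_k t_j t̄_k (real part). -/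
noncomputable def hessForm {d : ℕ} (f : (Fin d → ℂ) → ℂ) (z t : Fin d → ℂ) : ℝ :=
  (∑ j, ∑ k, wd j (fun w => wdbar k f w) z * t j * (starRingEnd ℂ) (t k)).re

/-- The pairing ⟨∂f(z), t⟩ = ∑_j ∂f/∂z_j(z) t_j. -/
noncomputable def dpair {d : ℕ} (f : (Fin d → ℂ) → ℂ) (z t : Fin d → ℂ) : ℂ :=
  ∑ j, wd j f z * t j

/-- `vanishesTo f b` : f has vanishing order exactly `b` at 0. -/
def vanishesTo {E : Type*} [NormedAddCommGroup E] [NormedSpace ℝ E]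
    (f : ℂ → E) (b : ℕ) : Prop :=
  (∀ j < b, iteratedFDeriv ℝ j f 0 = 0) ∧ iteratedFDeriv ℝ b f 0 ≠ 0

/-- The set of ratios ord₀(f∘Φ)/ord₀(Φ−Φ(0)) over nonconstant holomorphic discs Φ
through `x₀` staying in `U`. -/
def typeRatios {E : Type*} [NormedAddCommGroup E] [NormedSpace ℂ E]
    (f : E → ℂ) (U : Set E) (x₀ : E) : Set ℝ :=
  {x | ∃ (Φ : ℂ → E) (a b : ℕ),
    DifferentiableOn ℂ Φ (Metric.ball 0 1) ∧ Set.MapsTo Φ (Metric.ball 0 1) U ∧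
    Φ 0 = x₀ ∧ 0 < b ∧ vanishesTo (fun ζ => Φ ζ - x₀) b ∧
    vanishesTo (fun ζ => f (Φ ζ)) a ∧ x = (a : ℝ) / b}

/-- `f` (equivalently the hypersurface {f = 0}) is of finite (D'Angelo 1-)type `τ`
at `x₀` within `U`: no nonconstant holomorphic disc makes f∘Φ flat at 0, and `τ` is the
supremum of the order ratios. -/
def IsFiniteTypeAt {E : Type*} [NormedAddCommGroup E] [NormedSpace ℂ E]
    (f : E → ℂ) (U : Set E) (x₀ : E) (τ : ℝ) : Prop :=
  (∀ Φ : ℂ → E, DifferentiableOn ℂ Φ (Metric.ball 0 1) →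
      Set.MapsTo Φ (Metric.ball 0 1) U → Φ 0 = x₀ →
      (∃ b, 0 < b ∧ vanishesTo (fun ζ => Φ ζ - x₀) b) →
      ∃ a, vanishesTo (fun ζ => f (Φ ζ)) a) ∧
  IsLUB (typeRatios f U x₀) τ

section DiscContact

open Filter Topology Asymptotics ContDiff

section VanishingOrder

universe u
variable {E F : Type u} [NormedAddCommGroup E] [NormedSpace ℝ E]
  [NormedAddCommGroup F] [NormedSpace ℝ F]

theorem iteratedFDeriv_fderiv_eq_zero_iff {f : E → F} {x : E} {n : ℕ} :
    iteratedFDeriv ℝ n (fderiv ℝ f) x = 0 ↔ iteratedFDeriv ℝ (n + 1) f x = 0 := by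
  rw [← norm_eq_zero, norm_iteratedFDeriv_fderiv, norm_eq_zero]

/-- A function whose derivatives of order `< b` vanish at the origin is `O(‖x‖ ^ b)`. -/
theorem isBigO_norm_pow_of_iteratedFDeriv_eq_zero {f : E → F} {b : ℕ}
    (hf : ContDiffAt ℝ b f 0) (h : ∀ j < b, iteratedFDeriv ℝ j f 0 = 0) :
    f =O[𝓝 0] fun x => ‖x‖ ^ b := by
  induction b generalizing F f with
  | zero => simpa using hf.continuousAt.tendsto.isBigO_one ℝ
  | succ b ih =>
    have hd := ih (f := fderiv ℝ f) (hf.fderiv_right (by norm_cast)) fun j hj =>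
      iteratedFDeriv_fderiv_eq_zero_iff.2 (h (j + 1) (by omega))
    obtain ⟨C, hC0, hC⟩ := hd.exists_nonneg
    have hdiff : ∀ᶠ x in 𝓝 (0 : E), DifferentiableAt ℝ f x :=
      ((hf.of_le (m := 1) (by norm_cast; omega)).eventually (by simp)).mono
        fun x hx => hx.differentiableAt (by simp)
    obtain ⟨ε, hε, hball⟩ := Metric.eventually_nhds_iff_ball.1 (hdiff.and hC.bound)
    have h0 : f 0 = 0 := by
      have := h 0 (by omega)
      simpa using congrArg (fun A => A (fun _ => (0 : E))) this
    refine IsBigO.of_bound C (Metric.eventually_nhds_iff_ball.2 ⟨ε, hε, fun x hx => ?_⟩)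
    have hconv : Convex ℝ (Metric.ball (0 : E) ε ∩ Metric.closedBall 0 ‖x‖) :=
      (convex_ball _ _).inter (convex_closedBall _ _)
    have := hconv.norm_image_sub_le_of_norm_fderiv_le (𝕜 := ℝ) (f := f) (x := 0) (y := x)
      (C := C * ‖x‖ ^ b) (fun y hy => (hball y hy.1).1)
      (fun y hy => by
        refine (hball y hy.1).2.trans ?_
        have : ‖y‖ ≤ ‖x‖ := by simpa using hy.2
        simp only [norm_pow, norm_norm]
        gcongr)
      ⟨by simpa using hε, by simp⟩ ⟨hx, by simp⟩
    simpa [h0, pow_succ, mul_assoc] using this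

/-- Iterated real derivatives of smooth functions are symmetric. -/
theorem ContDiffAt.iteratedFDeriv_comp_perm_real {f : E → F} {x : E} {n : ℕ}
    (hf : ContDiffAt ℝ n f x) (v : Fin n → E) (σ : Equiv.Perm (Fin n)) :
    iteratedFDeriv ℝ n f x (v ∘ σ) = iteratedFDeriv ℝ n f x v := by
  induction n generalizing x with
  | zero => congr 1; ext i; exact i.elim0
  | succ n ih =>
    have hσ : σ ∈ Submonoid.closure
        (Set.range fun i : Fin n => Equiv.swap i.castSucc i.succ) := by
      rw [Equiv.Perm.mclosure_swap_castSucc_succ]; trivial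
    induction hσ using Submonoid.closure_induction generalizing v with
    | one => rfl
    | mul σ τ _ _ hσ hτ =>
      rw [Equiv.Perm.coe_mul, ← Function.comp_assoc, hτ, hσ]
    | mem σ hσ =>
      obtain ⟨i, rfl⟩ := hσ
      cases n with
      | zero => exact i.elim0
      | succ n =>
        refine Fin.cases ?_ (fun i => ?_) i
        · have hsymm : IsSymmSndFDerivAt ℝ (iteratedFDeriv ℝ n f) x :=
            (hf.iteratedFDeriv_right (m := 2) (i := n) (by norm_cast; omega)).isSymmSndFDerivAt
              (by simp)
          have key : ∀ w : Fin (n + 2) → E, iteratedFDeriv ℝ (n + 2) f x w =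
              fderiv ℝ (fderiv ℝ (iteratedFDeriv ℝ n f)) x (w 0) (w 1)
                (Fin.tail (Fin.tail w)) := by
            intro w
            have hd : DifferentiableAt ℝ (fderiv ℝ (iteratedFDeriv ℝ n f)) x :=
              ((hf.iteratedFDeriv_right (m := 2) (i := n) (by norm_cast; omega)).fderiv_right
                (m := 1) (by norm_num)).differentiableAt (by simp)
            have hd' : DifferentiableAt ℝ (iteratedFDeriv ℝ (n + 1) f) x :=
              (hf.iteratedFDeriv_right (m := 1) (i := n + 1)
                (by norm_cast; omega)).differentiableAt (by simp)
            rw [hd'.iteratedFDeriv_succ_apply_left']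
            simp only [iteratedFDeriv_succ_apply_left]
            have h1 := (hd.hasFDerivAt.clm_apply (hasFDerivAt_const (w 1) x))
            have h2 := (h1.continuousMultilinear_apply_const (Fin.tail (Fin.tail w))).fderiv
            refine (congrArg (fun L => L (w 0)) h2).trans ?_
            simp
          rw [key, key]
          have e0 : (v ∘ Equiv.swap (Fin.castSucc (0 : Fin (n + 1))) (Fin.succ 0)) 0 = v 1 := by
            simp
          have e1 : (v ∘ Equiv.swap (Fin.castSucc (0 : Fin (n + 1))) (Fin.succ 0)) 1 = v 0 := by
            simp
          have e2 : Fin.tail (Fin.tail (v ∘ Equiv.swap (Fin.castSucc (0 : Fin (n + 1)))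
              (Fin.succ 0))) = Fin.tail (Fin.tail v) := by
            ext j
            simp only [Fin.tail, Function.comp]
            rw [Equiv.swap_apply_of_ne_of_ne]
            · simp
            · simp [Fin.ext_iff]
          rw [e0, e1, e2, hsymm.eq]
        · have hev : (fun y => iteratedFDeriv ℝ (n + 1) f y
              (Fin.tail (v ∘ Equiv.swap (Fin.castSucc i.succ) (Fin.succ i.succ)))) =ᶠ[𝓝 x]
              fun y => iteratedFDeriv ℝ (n + 1) f y (Fin.tail v) := by
            filter_upwards [(hf.of_le (m := (n + 1 : ℕ)) (by norm_cast; omega)).eventually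
              (by simp)] with y hy
            rw [← ih hy (Fin.tail v) (Equiv.swap i.castSucc i.succ)]
            congr 1
            ext j
            simp only [Fin.tail, Function.comp]
            congr 1
            rw [← Fin.succ_castSucc, Equiv.swap_apply_def, Equiv.swap_apply_def]
            simp only [Fin.succ_inj]
            split_ifs <;> rfl
          have hd : DifferentiableAt ℝ (iteratedFDeriv ℝ (n + 1) f) x :=
            (hf.iteratedFDeriv_right (m := 1) (i := n + 1)
              (by norm_cast; omega)).differentiableAt (by simp)
          have key : ∀ w : Fin (n + 2) → E, iteratedFDeriv ℝ (n + 2) f x w =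
              fderiv ℝ (fun y => iteratedFDeriv ℝ (n + 1) f y (Fin.tail w)) x (w 0) := by
            intro w
            exact hd.iteratedFDeriv_succ_apply_left'
          rw [key, key, hev.fderiv_eq]
          congr 1

/-- The homogeneous Taylor polynomial of degree `a` of `f` at the origin. -/
noncomputable def homogeneousJet (f : E → F) (a : ℕ) (x : E) : F :=
  (a.factorial : ℝ)⁻¹ • iteratedFDeriv ℝ a f 0 fun _ => x

theorem contDiff_homogeneousJet (f : E → F) (a : ℕ) {n : WithTop ℕ∞} :
    ContDiff ℝ n (homogeneousJet f a) :=
  ((iteratedFDeriv ℝ a f 0).contDiff.comp (contDiff_pi.2 fun _ => contDiff_id)).const_smul _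

theorem homogeneousJet_smul (f : E → F) (a : ℕ) (t : ℝ) (x : E) :
    homogeneousJet f a (t • x) = t ^ a • homogeneousJet f a x := by
  have := (iteratedFDeriv ℝ a f 0).map_smul_univ (fun _ => t) (fun _ => x)
  simp only [Finset.prod_const, Finset.card_univ, Fintype.card_fin] at this
  rw [homogeneousJet, homogeneousJet, this, smul_comm]

theorem iteratedFDeriv_homogeneousJet_of_ne (f : E → F) {a j : ℕ} (hj : j ≠ a) :
    iteratedFDeriv ℝ j (homogeneousJet f a) 0 = 0 := by
  have hp : HasFiniteFPowerSeriesOnBall (homogeneousJet f a)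
      (fun k => if h : a = k then h ▸ ((a.factorial : ℝ)⁻¹ • iteratedFDeriv ℝ a f 0) else 0)
      0 (a + 1) ⊤ := by
    apply HasFiniteFPowerSeriesOnBall.mk' _ (by simp)
    · intro y _
      rw [Finset.sum_eq_single_of_mem a (by simp)]
      · simp [homogeneousJet]
      · intro i _ hi
        simp [hi.symm]
    · intro m hm
      have : a ≠ m := by omega
      simp [this]
  ext v
  rw [hp.toHasFPowerSeriesOnBall.iteratedFDeriv_eq_sum
    (contDiff_homogeneousJet f a).contDiffOn.analyticOn]
  simp [hj.symm]

theorem iteratedFDeriv_homogeneousJet_self {f : E → F} {a : ℕ} (hf : ContDiffAt ℝ a f 0) :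
    iteratedFDeriv ℝ a (homogeneousJet f a) 0 = iteratedFDeriv ℝ a f 0 := by
  ext v
  have h1 : homogeneousJet f a =
      fun x => ((a.factorial : ℝ)⁻¹ • iteratedFDeriv ℝ a f 0) fun _ => x := rfl
  rw [h1, ContinuousMultilinearMap.iteratedFDeriv_comp_diagonal]
  have h2 : ∀ σ : Equiv.Perm (Fin a),
      iteratedFDeriv ℝ a f 0 (fun i => v (σ i)) = iteratedFDeriv ℝ a f 0 v :=
    hf.iteratedFDeriv_comp_perm_real v
  simp only [smul_apply, h2, Finset.sum_const, Finset.card_univ, Fintype.card_perm,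
    Fintype.card_fin, ← Nat.cast_smul_eq_nsmul ℝ]
  rw [smul_smul, mul_inv_cancel₀ (by positivity), one_smul]

/-- Subtracting the leading homogeneous part raises the vanishing order. -/
theorem iteratedFDeriv_sub_homogeneousJet {f : E → F} {a : ℕ} (hf : ContDiffAt ℝ a f 0)
    (h : ∀ j < a, iteratedFDeriv ℝ j f 0 = 0) {j : ℕ} (hj : j < a + 1) :
    iteratedFDeriv ℝ j (fun x => f x - homogeneousJet f a x) 0 = 0 := by
  rw [fun_iteratedFDeriv_sub_apply (hf.of_le (by norm_cast; omega))
    (contDiff_homogeneousJet f a).contDiffAt]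
  rcases eq_or_ne j a with rfl | hne
  · rw [iteratedFDeriv_homogeneousJet_self hf, sub_self]
  · rw [iteratedFDeriv_homogeneousJet_of_ne f hne, h j (by omega), sub_zero]

end VanishingOrder

section PlaneLaplacian

/-- The Laplacian of a function on the complex plane. -/
noncomputable def planeLaplacian (f : ℂ → ℝ) (z : ℂ) : ℝ :=
  fderiv ℝ (fderiv ℝ f) z 1 1 + fderiv ℝ (fderiv ℝ f) z Complex.I Complex.I

theorem bilin_rotate (B : ℂ →L[ℝ] ℂ →L[ℝ] ℝ) (u : ℂ) :
    B (Complex.I * u) (Complex.I * u) + B u u =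
      ‖u‖ ^ 2 * (B 1 1 + B Complex.I Complex.I) := by
  have h1 : u = u.re • (1 : ℂ) + u.im • Complex.I := by
    simp [Complex.re_add_im]
  have h2 : Complex.I * u = (-u.im) • (1 : ℂ) + u.re • Complex.I := by
    apply Complex.ext <;> simp
  have hn : ‖u‖ ^ 2 = u.re ^ 2 + u.im ^ 2 := by
    rw [← Complex.normSq_eq_norm_sq, Complex.normSq_apply]; ring
  rw [h2, hn]
  generalize u.re = x at *
  generalize u.im = y at *
  subst h1
  simp only [map_add, map_smul, add_apply, smul_apply, smul_eq_mul]
  ring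

/-- A homogeneous function that is nonpositive and subharmonic vanishes identically. -/
theorem eq_zero_of_homogeneous_of_laplacian_nonneg {P : ℂ → ℝ} {a : ℕ} (ha : a ≠ 0)
    (hP : ContDiff ℝ 2 P) (hhom : ∀ (t : ℝ) z, P (t • z) = t ^ a • P z)
    (hlap : ∀ z, 0 ≤ planeLaplacian P z) (hneg : ∀ z, P z ≤ 0) : P = 0 := by
  have hd1 : Differentiable ℝ P := hP.differentiable (by simp)
  have hd2 : Differentiable ℝ (fderiv ℝ P) :=
    (hP.fderiv_right (m := 1) (by norm_num)).differentiable (by simp)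
  have euler : ∀ z, fderiv ℝ P z z = a * P z := by
    intro z
    have h1 : HasDerivAt (fun t : ℝ => P (t • z)) (fderiv ℝ P ((1 : ℝ) • z) ((1 : ℝ) • z)) 1 :=
      (hd1 _).hasFDerivAt.comp_hasDerivAt (1 : ℝ) ((hasDerivAt_id (1 : ℝ)).smul_const z)
    have h2 : HasDerivAt (fun t : ℝ => t ^ a • P z) ((a * 1 ^ (a - 1) : ℝ) • P z) 1 :=
      (hasDerivAt_pow a (1 : ℝ)).smul_const (P z)
    simp only [hhom] at h1
    simpa using h1.unique h2
  have euler2 : ∀ z, fderiv ℝ (fderiv ℝ P) z z z + a * P z = a * (a * P z) := by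
    intro z
    have h1 := (hd2 z).hasFDerivAt.clm_apply (hasFDerivAt_id z)
    have h2 : HasFDerivAt (fun z => fderiv ℝ P z (id z)) ((a : ℝ) • fderiv ℝ P z) z := by
      simp only [id, euler]
      exact (hd1 z).hasFDerivAt.const_mul (a : ℝ)
    have := congrArg (fun L => L z) (h1.unique h2)
    simp only [id, add_apply, ContinuousLinearMap.comp_apply, ContinuousLinearMap.id_apply,
      ContinuousLinearMap.flip_apply, smul_apply, smul_eq_mul, euler] at this
    linarith
  set e : ℝ → ℂ := fun θ => Complex.exp (θ * Complex.I) with he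
  have hnorm : ∀ θ, ‖e θ‖ = 1 := fun θ => Complex.norm_exp_ofReal_mul_I θ
  have hde : ∀ θ, HasDerivAt e (Complex.I * e θ) θ := by
    intro θ
    have h1 : HasDerivAt (fun θ : ℝ => (θ : ℂ) * Complex.I) (1 * Complex.I) θ :=
      (Complex.ofRealCLM.hasDerivAt (x := θ)).mul_const Complex.I
    have := h1.cexp
    convert this using 1
    simp only [he]; ring
  set q : ℝ → ℝ := fun θ => fderiv ℝ P (e θ) (Complex.I * e θ) with hq
  have hdq : ∀ θ, HasDerivAt q (planeLaplacian P (e θ) - (a : ℝ) ^ 2 * P (e θ)) θ := by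
    intro θ
    have h1 := ((hd2 (e θ)).hasFDerivAt.comp_hasDerivAt θ (hde θ)).clm_apply
      ((hde θ).const_mul Complex.I)
    refine h1.congr_deriv ?_
    have h3 : Complex.I * (Complex.I * e θ) = -e θ := by
      rw [← mul_assoc, Complex.I_mul_I]; ring
    have h4 := bilin_rotate (fderiv ℝ (fderiv ℝ P) (e θ)) (e θ)
    have h5 := euler2 (e θ)
    rw [hnorm, one_pow, one_mul] at h4
    rw [h3, map_neg, Function.comp_apply, euler, planeLaplacian]
    linarith
  have hmono : Monotone q := monotone_of_deriv_nonneg (fun θ => (hdq θ).differentiableAt)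
    fun θ => by
      rw [(hdq θ).deriv]
      nlinarith [hlap (e θ), hneg (e θ), sq_nonneg (a : ℝ)]
  have hper : Function.Periodic q (2 * Real.pi) := by
    intro θ
    have : e (θ + 2 * Real.pi) = e θ := by
      simp only [he]
      rw [Complex.exp_eq_exp_iff_exists_int]
      exact ⟨1, by push_cast; ring⟩
    simp only [hq, this]
  have hconst : ∀ x y, x ≤ y → q x = q y := by
    intro x y hxy
    obtain ⟨n, hn⟩ := exists_nat_gt ((y - x) / (2 * Real.pi))
    refine le_antisymm (hmono hxy) ?_
    have h2 : y ≤ x + n * (2 * Real.pi) := by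
      rw [div_lt_iff₀ (by positivity)] at hn; linarith
    exact (hmono h2).trans_eq (hper.nat_mul n x)
  have hq0 : ∀ θ, P (e θ) = 0 := by
    intro θ
    have h1 : q = fun _ => q 0 := by
      ext x
      rcases le_total x 0 with h | h
      · exact hconst _ _ h
      · exact (hconst _ _ h).symm
    have h2 := hdq θ
    rw [h1] at h2
    have h3 := h2.unique (hasDerivAt_const θ (q 0))
    have ha2 : (0 : ℝ) < (a : ℝ) ^ 2 := by positivity
    have h4 := hlap (e θ)
    refine le_antisymm (hneg _) ?_
    by_contra! hlt
    nlinarith [mul_pos ha2 (neg_pos.2 hlt)]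
  ext z
  have hz : z = ‖z‖ • e z.arg := by
    simp [he, Complex.norm_mul_exp_arg_mul_I]
  rw [hz, hhom, hq0]; simp

theorem nonneg_of_eventually_pow_le {a : ℕ} {x C : ℝ}
    (h : ∀ᶠ t in 𝓝[>] (0 : ℝ), -(C * t ^ (a + 1)) ≤ t ^ a * x) : 0 ≤ x := by
  have h1 : Tendsto (fun t : ℝ => -(C * t)) (𝓝[>] 0) (𝓝 0) := by
    have : Continuous fun t : ℝ => -(C * t) := by fun_prop
    simpa using (this.tendsto 0).mono_left nhdsWithin_le_nhds
  refine le_of_tendsto h1 ?_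
  filter_upwards [h, self_mem_nhdsWithin] with t ht ht0
  have ht0 : 0 < t := ht0
  have : 0 ≤ t ^ a * (x + C * t) := by rw [pow_succ] at ht; linarith
  have := nonneg_of_mul_nonneg_right this (by positivity)
  linarith

theorem homogeneousJet_nonneg {g : ℂ → ℝ} {a : ℕ} (hg : ContDiffAt ℝ (a + 1 : ℕ) g 0)
    (hvan : ∀ j < a, iteratedFDeriv ℝ j g 0 = 0) (hnn : ∀ᶠ z in 𝓝 0, 0 ≤ g z) (z : ℂ) :
    0 ≤ homogeneousJet g a z := by
  have hO := isBigO_norm_pow_of_iteratedFDeriv_eq_zero (b := a + 1)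
    (f := fun z => g z - homogeneousJet g a z)
    (hg.sub (contDiff_homogeneousJet g a).contDiffAt)
    fun j hj => iteratedFDeriv_sub_homogeneousJet (hg.of_le (by norm_cast; omega)) hvan hj
  obtain ⟨C, hC⟩ := hO.bound
  have hlim : Tendsto (fun t : ℝ => t • z) (𝓝[>] 0) (𝓝 0) := by
    have : Continuous fun t : ℝ => t • z := by fun_prop
    simpa using (this.tendsto 0).mono_left nhdsWithin_le_nhds
  refine nonneg_of_eventually_pow_le (a := a) (C := C * ‖z‖ ^ (a + 1)) ?_
  filter_upwards [hlim.eventually (hC.and hnn), self_mem_nhdsWithin] with t ht ht0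
  obtain ⟨h1, h2⟩ := ht
  have ht0 : 0 < t := ht0
  rw [homogeneousJet_smul, Real.norm_eq_abs, abs_le, norm_pow, norm_norm, norm_smul,
    Real.norm_of_nonneg ht0.le, mul_pow, smul_eq_mul] at h1
  linarith [h1.2]

theorem planeLaplacian_homogeneousJet_smul (f : ℂ → ℝ) (a : ℕ) (t : ℝ) (z : ℂ) :
    t ^ 2 * planeLaplacian (homogeneousJet f a) (t • z) =
      t ^ a * planeLaplacian (homogeneousJet f a) z := by
  set P := homogeneousJet f a with hPdef
  have hP : ContDiff ℝ 2 P := contDiff_homogeneousJet f a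
  have hd1 : Differentiable ℝ P := hP.differentiable (by simp)
  have hd2 : Differentiable ℝ (fderiv ℝ P) :=
    (hP.fderiv_right (m := 1) (by norm_num)).differentiable (by simp)
  have h1 : (fun z => t • fderiv ℝ P (t • z)) = fun z => t ^ a • fderiv ℝ P z := by
    ext1 z
    have hl : HasFDerivAt (fun z => P (t • z))
        ((fderiv ℝ P (t • z)).comp (t • ContinuousLinearMap.id ℝ ℂ)) z :=
      (hd1 _).hasFDerivAt.comp z ((hasFDerivAt_id z).const_smul t)
    have hr : HasFDerivAt (fun z => P (t • z)) (t ^ a • fderiv ℝ P z) z := by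
      simp only [hPdef, homogeneousJet_smul]
      exact (hd1 z).hasFDerivAt.const_smul (t ^ a)
    rw [← hl.unique hr]
    ext v
    simp
  have h2 : t • (t • fderiv ℝ (fderiv ℝ P) (t • z)) = t ^ a • fderiv ℝ (fderiv ℝ P) z := by
    have hl : HasFDerivAt (fun z => t • fderiv ℝ P (t • z))
        (t • (fderiv ℝ (fderiv ℝ P) (t • z)).comp (t • ContinuousLinearMap.id ℝ ℂ)) z :=
      ((hd2 _).hasFDerivAt.comp z ((hasFDerivAt_id z).const_smul t)).const_smul t
    have hr : HasFDerivAt (fun z => t • fderiv ℝ P (t • z))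
        (t ^ a • fderiv ℝ (fderiv ℝ P) z) z := by
      rw [h1]
      exact (hd2 z).hasFDerivAt.const_smul (t ^ a)
    rw [← hl.unique hr]
    ext v w
    simp
  have h3 := congrArg (fun B : ℂ →L[ℝ] ℂ →L[ℝ] ℝ => B 1 1 + B Complex.I Complex.I) h2
  simp only [smul_apply, smul_eq_mul] at h3
  simp only [planeLaplacian]
  linarith

theorem planeLaplacian_homogeneousJet_nonneg {f : ℂ → ℝ} {a : ℕ} (ha : a ≠ 0)
    (hf : ContDiffAt ℝ (a + 1 : ℕ) f 0) (hvan : ∀ j < a, iteratedFDeriv ℝ j f 0 = 0) {C : ℝ}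
    (hlap : ∀ᶠ z in 𝓝 0, -(C * ‖z‖ ^ (a - 1)) ≤ planeLaplacian f z) (z : ℂ) :
    0 ≤ planeLaplacian (homogeneousJet f a) z := by
  obtain ⟨b, rfl⟩ := Nat.exists_eq_succ_of_ne_zero ha
  set P := homogeneousJet f (b + 1) with hPdef
  have hP : ContDiff ℝ (b + 2 : ℕ) P := contDiff_homogeneousJet f (b + 1)
  have hd : ContDiffAt ℝ (b + 2 : ℕ) (fun z => f z - P z) 0 := hf.sub hP.contDiffAt
  have hO := isBigO_norm_pow_of_iteratedFDeriv_eq_zero (b := b)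
    (f := fderiv ℝ (fderiv ℝ fun z => f z - P z))
    ((hd.fderiv_right (m := (b + 1 : ℕ)) (by norm_cast)).fderiv_right (m := (b : ℕ))
      (by norm_cast))
    fun j hj => iteratedFDeriv_fderiv_eq_zero_iff.2 <| iteratedFDeriv_fderiv_eq_zero_iff.2 <|
      iteratedFDeriv_sub_homogeneousJet (hf.of_le (by norm_cast; omega)) hvan (by omega)
  obtain ⟨K, hK⟩ := hO.bound
  have hsub : ∀ᶠ z in 𝓝 (0 : ℂ), fderiv ℝ (fderiv ℝ fun z => f z - P z) z =
      fderiv ℝ (fderiv ℝ f) z - fderiv ℝ (fderiv ℝ P) z := by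
    have hf2 : ContDiffAt ℝ 2 f 0 := hf.of_le (by norm_cast; omega)
    have hP2 : ContDiff ℝ 2 P := hP.of_le (by norm_cast; omega)
    have h1 := (hf2.eventually (by simp)).eventually_nhds
    filter_upwards [h1] with z hz
    have : fderiv ℝ (fun z => f z - P z) =ᶠ[𝓝 z] fun z => fderiv ℝ f z - fderiv ℝ P z := by
      filter_upwards [hz] with y hy
      exact fderiv_fun_sub (hy.differentiableAt (by simp)) (hP2.differentiable (by simp) y)
    rw [this.fderiv_eq]
    exact fderiv_fun_sub
      ((hz.self_of_nhds.fderiv_right (m := 1) (by norm_num)).differentiableAt (by simp))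
      ((hP2.fderiv_right (m := 1) (by norm_num)).differentiable (by simp) z)
  have hlim : Tendsto (fun t : ℝ => t • z) (𝓝[>] 0) (𝓝 0) := by
    have : Continuous fun t : ℝ => t • z := by fun_prop
    simpa using (this.tendsto 0).mono_left nhdsWithin_le_nhds
  refine nonneg_of_eventually_pow_le (a := b + 1) (C := (C + 2 * K) * ‖z‖ ^ b) ?_
  filter_upwards [hlim.eventually (hK.and (hsub.and hlap)), self_mem_nhdsWithin] with t ht ht0
  obtain ⟨h1, h2, h3⟩ := ht
  have ht0 : 0 < t := ht0
  rw [h2] at h1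
  have hb : ∀ u : ℂ, ‖u‖ = 1 → |fderiv ℝ (fderiv ℝ f) (t • z) u u -
      fderiv ℝ (fderiv ℝ P) (t • z) u u| ≤ K * (t ^ b * ‖z‖ ^ b) := by
    intro u hu
    have := (fderiv ℝ (fderiv ℝ f) (t • z) - fderiv ℝ (fderiv ℝ P) (t • z)).le_opNorm₂ u u
    rw [hu, mul_one, mul_one] at this
    refine (this.trans h1).trans_eq ?_
    rw [norm_pow, norm_norm, norm_smul, Real.norm_of_nonneg ht0.le, mul_pow]
  have hb1 := (abs_le.1 (hb 1 (by simp))).2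
  have hbI := (abs_le.1 (hb Complex.I (by simp))).2
  rw [← planeLaplacian_homogeneousJet_smul, ← hPdef]
  simp only [Nat.succ_eq_add_one, Nat.add_sub_cancel, norm_smul, Real.norm_of_nonneg ht0.le,
    mul_pow] at h3
  have key : -((C + 2 * K) * (t ^ b * ‖z‖ ^ b)) ≤ planeLaplacian P (t • z) := by
    simp only [planeLaplacian] at h3 ⊢
    linarith
  have := mul_le_mul_of_nonneg_left key (sq_nonneg t)
  refine le_trans (le_of_eq ?_) this
  ring

/-- No cancellation of leading terms: an almost subharmonic function and a nonnegative function
vanishing to the same order have a sum vanishing to that order. -/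
theorem iteratedFDeriv_add_ne_zero {f g : ℂ → ℝ} {a : ℕ} (ha : a ≠ 0)
    (hf : ContDiffAt ℝ (a + 1 : ℕ) f 0) (hg : ContDiffAt ℝ (a + 1 : ℕ) g 0)
    (hfv : ∀ j < a, iteratedFDeriv ℝ j f 0 = 0) (hgv : ∀ j < a, iteratedFDeriv ℝ j g 0 = 0)
    {C : ℝ} (hlap : ∀ᶠ z in 𝓝 0, -(C * ‖z‖ ^ (a - 1)) ≤ planeLaplacian f z)
    (hnn : ∀ᶠ z in 𝓝 0, 0 ≤ g z) (hga : iteratedFDeriv ℝ a g 0 ≠ 0) :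
    iteratedFDeriv ℝ a (fun z => f z + g z) 0 ≠ 0 := by
  intro h
  have hfa : ContDiffAt ℝ a f 0 := hf.of_le (by norm_cast; omega)
  have hgA : ContDiffAt ℝ a g 0 := hg.of_le (by norm_cast; omega)
  rw [fun_iteratedFDeriv_add_apply hfa hgA] at h
  have hsum : ∀ z, homogeneousJet f a z + homogeneousJet g a z = 0 := by
    intro z
    rw [homogeneousJet, homogeneousJet, ← smul_add, ← add_apply, h]
    simp
  have hP : homogeneousJet f a = 0 :=
    eq_zero_of_homogeneous_of_laplacian_nonneg ha (contDiff_homogeneousJet f a)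
      (homogeneousJet_smul f a) (planeLaplacian_homogeneousJet_nonneg ha hf hfv hlap)
      fun z => by linarith [hsum z, homogeneousJet_nonneg hg hgv hnn z]
  have hQ : homogeneousJet g a = 0 := by
    ext z
    simpa [hP] using hsum z
  apply hga
  rw [← iteratedFDeriv_homogeneousJet_self hgA, hQ]
  exact congrFun iteratedFDeriv_fun_zero 0

end PlaneLaplacian

section LeviForm

universe v

variable {E : Type v} [NormedAddCommGroup E] [NormedSpace ℂ E]

theorem eventually_exists_root_on_line {R : E → ℝ} (hR : ContDiffAt ℝ 1 R 0) (hR0 : R 0 = 0)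
    {v : E} (hv : fderiv ℝ R 0 v = 1) :
    ∀ᶠ z in 𝓝 0, ∃ s : ℝ, |s| ≤ 2 * |R z| ∧ R (z + s • v) = 0 := by
  have hstrict := hR.hasStrictFDerivAt (by simp)
  have hlin := hstrict.isLittleO.def (c := (2 * (‖v‖ + 1))⁻¹) (by positivity)
  have hev : ∀ᶠ x in 𝓝 (0 : E), ContinuousAt R x :=
    (hR.eventually (by simp)).mono fun x hx => hx.continuousAt
  have hmap : Tendsto (fun p : E × ℝ => (p.1 + p.2 • v, p.1)) (𝓝 (0, 0))
      (𝓝 ((0 : E), (0 : E))) := by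
    have : Continuous fun p : E × ℝ => (p.1 + p.2 • v, p.1) := by fun_prop
    simpa using this.tendsto (0, 0)
  have hall := hmap.eventually (hlin.and (hev.prod_inl_nhds (0 : E)))
  rw [nhds_prod_eq] at hall
  obtain ⟨p, hp, q, hq, hpq⟩ := eventually_prod_iff.1 hall
  obtain ⟨δ, hδ, hball⟩ := Metric.eventually_nhds_iff.1 hq
  have hsmall : ∀ᶠ z in 𝓝 (0 : E), 2 * |R z| < δ := by
    have : Tendsto (fun z => 2 * |R z|) (𝓝 0) (𝓝 (2 * |R 0|)) :=
      hR.continuousAt.abs.const_mul 2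
    exact this.eventually_lt_const (by simpa [hR0])
  filter_upwards [hp, hsmall] with z hz hzs
  set b := 2 * |R z| with hb
  have hb0 : 0 ≤ b := by positivity
  have hs : ∀ s ∈ Set.Icc (-b) b, |R (z + s • v) - R z - s| ≤ |s| / 2 ∧
      ContinuousAt R (z + s • v) := by
    intro s hs
    obtain ⟨h1, h2⟩ := hpq hz (hball (y := s) (by
      rw [dist_zero_right, Real.norm_eq_abs]
      exact (abs_le.2 hs).trans_lt hzs))
    refine ⟨?_, h2⟩
    simp only [add_sub_cancel_left, map_smul, hv, smul_eq_mul, mul_one, norm_smul,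
      Real.norm_eq_abs] at h1
    refine h1.trans ?_
    have : (2 * (‖v‖ + 1))⁻¹ * ‖v‖ ≤ 1 / 2 := by
      rw [inv_mul_le_iff₀ (by positivity)]; linarith [norm_nonneg v]
    nlinarith [abs_nonneg s]
  have hcont : ContinuousOn (fun s : ℝ => R (z + s • v)) (Set.Icc (-b) b) := fun s hs' =>
    (ContinuousAt.comp (f := fun s : ℝ => z + s • v) (hs s hs').2
      (by fun_prop)).continuousWithinAt
  have hle : -b ≤ b := by linarith
  have hlo := abs_le.1 (hs (-b) ⟨le_rfl, hle⟩).1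
  have hhi := abs_le.1 (hs b ⟨hle, le_rfl⟩).1
  rw [abs_neg, abs_of_nonneg hb0] at hlo
  rw [abs_of_nonneg hb0] at hhi
  have hRz := abs_le.1 (le_refl |R z|)
  obtain ⟨s, hs1, hs2⟩ := intermediate_value_Icc hle hcont
    (show (0 : ℝ) ∈ Set.Icc _ _ from ⟨by linarith [hlo.2], by linarith [hhi.1]⟩)
  exact ⟨s, abs_le.2 hs1, hs2⟩

/-- The Levi form of a real function, up to the factor `4`. -/
noncomputable def leviForm (R : E → ℝ) (z t : E) : ℝ :=
  fderiv ℝ (fderiv ℝ R) z t t + fderiv ℝ (fderiv ℝ R) z (Complex.I • t) (Complex.I • t)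

/-- The complex-linear functional whose real part is `L`. -/
noncomputable def complexPart (L : E →L[ℝ] ℝ) (t : E) : ℂ :=
  ⟨L t, -L (Complex.I • t)⟩

theorem complexPart_sub_smul (L : E →L[ℝ] ℝ) (t v : E) (c : ℂ) :
    complexPart L (t - c • v) = complexPart L t - c * complexPart L v := by
  have h : ∀ c : ℂ, L (c • v) = c.re * L v + c.im * L (Complex.I • v) := by
    intro c
    conv_lhs => rw [← Complex.re_add_im c, add_smul, mul_smul, map_add]
    rw [Complex.coe_smul, Complex.coe_smul, map_smul, map_smul, smul_eq_mul, smul_eq_mul]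
  have h2 : L (Complex.I • c • v) = -c.im * L v + c.re * L (Complex.I • v) := by
    rw [smul_smul, h]; simp
  apply Complex.ext
  · simp [complexPart, h c]
  · simp [complexPart, smul_sub, h2]; ring

theorem norm_complexPart_le (L : E →L[ℝ] ℝ) (t : E) :
    ‖complexPart L t‖ ≤ |L t| + |L (Complex.I • t)| := by
  simpa [complexPart] using Complex.norm_le_abs_re_add_abs_im (complexPart L t)

theorem fderiv_comp_holomorphic {R : E → ℝ} {φ : ℂ → E} {ζ : ℂ}
    (hR : DifferentiableAt ℝ R (φ ζ)) (hφ : DifferentiableAt ℂ φ ζ) (u : ℂ) :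
    fderiv ℝ (fun ζ => R (φ ζ)) ζ u = fderiv ℝ R (φ ζ) (u • deriv φ ζ) := by
  have h := hR.hasFDerivAt.comp ζ (hφ.hasDerivAt.hasFDerivAt.restrictScalars ℝ)
  have h' : HasFDerivAt (fun ζ => R (φ ζ)) _ ζ := h
  rw [h'.fderiv]
  simp

theorem planeLaplacian_comp_holomorphic [CompleteSpace E] {R : E → ℝ} {φ : ℂ → E} {ζ : ℂ}
    (hR : ContDiffAt ℝ 2 R (φ ζ)) (hφ : AnalyticAt ℂ φ ζ) :
    planeLaplacian (fun ζ => R (φ ζ)) ζ = leviForm R (φ ζ) (deriv φ ζ) := by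
  have hφev : ∀ᶠ y in 𝓝 ζ, DifferentiableAt ℂ φ y :=
    hφ.eventually_analyticAt.mono fun y hy => hy.differentiableAt
  have hRev : ∀ᶠ y in 𝓝 ζ, ContDiffAt ℝ 2 R (φ y) :=
    hφ.continuousAt.eventually (hR.eventually (by simp))
  have hcomp : ContDiffAt ℝ 2 (fun ζ => R (φ ζ)) ζ :=
    hR.comp ζ ((hφ.contDiffAt (n := 2)).restrict_scalars ℝ)
  have hd2 : DifferentiableAt ℝ (fderiv ℝ fun ζ => R (φ ζ)) ζ :=
    (hcomp.fderiv_right (m := 1) (by norm_num)).differentiableAt (by simp)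
  have hRd2 : DifferentiableAt ℝ (fderiv ℝ R) (φ ζ) :=
    (hR.fderiv_right (m := 1) (by norm_num)).differentiableAt (by simp)
  have key : ∀ u : ℂ, fderiv ℝ (fderiv ℝ fun ζ => R (φ ζ)) ζ u u =
      fderiv ℝ (fderiv ℝ R) (φ ζ) (u • deriv φ ζ) (u • deriv φ ζ) +
        fderiv ℝ R (φ ζ) (u • u • deriv (deriv φ) ζ) := by
    intro u
    have h1 := hd2.hasFDerivAt.clm_apply (hasFDerivAt_const u ζ)
    have h2 := (hRd2.hasFDerivAt.comp ζ
      (hφ.differentiableAt.hasDerivAt.hasFDerivAt.restrictScalars ℝ)).clm_apply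
        ((hφ.deriv.differentiableAt.hasDerivAt.hasFDerivAt.restrictScalars ℝ).const_smul u)
    have h3 : (fun ζ' => fderiv ℝ (fun ζ => R (φ ζ)) ζ' u) =ᶠ[𝓝 ζ]
        fun ζ' => fderiv ℝ R (φ ζ') (u • deriv φ ζ') := by
      filter_upwards [hφev, hRev] with y hy hy'
      exact fderiv_comp_holomorphic (hy'.differentiableAt (by simp)) hy u
    have h4 := congrArg (fun L => L u) (h1.unique (h2.congr_of_eventuallyEq h3))
    simp only [add_apply, ContinuousLinearMap.comp_apply,
      ContinuousLinearMap.flip_apply, zero_apply, map_zero] at h4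
    simpa [add_comm] using h4
  rw [planeLaplacian, key, key, leviForm, smul_smul Complex.I Complex.I, Complex.I_mul_I]
  simp only [one_smul, neg_smul, map_neg]
  ring

theorem isBigO_bilin_apply {α : Type*} {l : Filter α} {B : α → E →L[ℝ] E →L[ℝ] ℝ} {x y : α → E}
    {f g k : α → ℝ} (hB : B =O[l] f) (hx : x =O[l] g) (hy : y =O[l] k) :
    (fun i => B i (x i) (y i)) =O[l] fun i => f i * g i * k i := by
  refine IsBigO.trans (IsBigO.of_norm_le fun i => ?_)
    ((IsBigO.norm_left (E' := E →L[ℝ] E →L[ℝ] ℝ) hB).mul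
    hx.norm_left |>.mul hy.norm_left)
  exact (B i).le_opNorm₂ (x i) (y i)

theorem isBigO_clm_apply {α : Type*} {l : Filter α} {L : α → E →L[ℝ] ℝ} {x : α → E}
    {f g : α → ℝ} (hL : L =O[l] f) (hx : x =O[l] g) :
    (fun i => L i (x i)) =O[l] fun i => f i * g i := by
  refine IsBigO.trans (IsBigO.of_norm_le fun i => ?_)
    ((IsBigO.norm_left (E' := E →L[ℝ] ℝ) hL).mul hx.norm_left)
  exact (L i).le_opNorm (x i)

theorem isBigO_complexPart {α : Type*} {l : Filter α} {L : α → E →L[ℝ] ℝ} {x : α → E}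
    {f g : α → ℝ} (hL : L =O[l] f) (hx : x =O[l] g) :
    (fun i => complexPart (L i) (x i)) =O[l] fun i => f i * g i := by
  have hI : (fun i => Complex.I • x i) =O[l] g :=
    IsBigO.trans (IsBigO.of_norm_le fun i => by simp [norm_smul]) hx.norm_left
  refine IsBigO.trans (IsBigO.of_norm_le fun i => norm_complexPart_le (L i) (x i)) ?_
  exact (isBigO_clm_apply hL hx).norm_left.add (isBigO_clm_apply hL hI).norm_left

theorem isBigO_leviForm_sub {α : Type*} {l : Filter α} {R : E → ℝ} {x y t t' : α → E}
    {g : α → ℝ}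
    (hB : (fun i => fderiv ℝ (fderiv ℝ R) (x i) - fderiv ℝ (fderiv ℝ R) (y i)) =O[l] g)
    (hB1 : (fun i => fderiv ℝ (fderiv ℝ R) (y i)) =O[l] fun _ => (1 : ℝ))
    (ht : t =O[l] fun _ => (1 : ℝ)) (ht' : t' =O[l] fun _ => (1 : ℝ))
    (htt : (fun i => t' i - t i) =O[l] g) :
    (fun i => leviForm R (x i) (t' i) - leviForm R (y i) (t i)) =O[l] g := by
  have key : ∀ {t t' : α → E}, t =O[l] (fun _ => (1 : ℝ)) → t' =O[l] (fun _ => (1 : ℝ)) →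
      (fun i => t' i - t i) =O[l] g →
      (fun i => fderiv ℝ (fderiv ℝ R) (x i) (t' i) (t' i) -
        fderiv ℝ (fderiv ℝ R) (y i) (t i) (t i)) =O[l] g := by
    intro t t' ht ht' htt
    have h1 := isBigO_bilin_apply hB ht' ht'
    have h2 := isBigO_bilin_apply hB1 htt ht'
    have h3 := isBigO_bilin_apply hB1 ht htt
    simp only [mul_one, one_mul] at h1 h2 h3
    refine ((h1.add h2).add h3).congr_left fun i => ?_
    simp only [sub_apply, map_sub]
    ring
  have hI : ∀ {u : α → E} {k : α → ℝ}, u =O[l] k → (fun i => Complex.I • u i) =O[l] k :=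
    fun hu => IsBigO.trans (IsBigO.of_norm_le fun i => by simp [norm_smul]) hu.norm_left
  refine ((key ht ht' htt).add (key (hI ht) (hI ht') ?_)).congr_left fun i => ?_
  · simpa only [smul_sub] using hI htt
  · simp only [leviForm]
    ring

/-- Along a holomorphic disc on which a defining function of a pseudoconvex hypersurface vanishes
to order `a`, the Laplacian is bounded below by `-C‖ζ‖ ^ (a - 1)`. -/
theorem exists_le_planeLaplacian_of_leviForm_nonneg [CompleteSpace E] {R : E → ℝ}
    (hR : ContDiffAt ℝ 3 R 0) (hR0 : R 0 = 0) (hdR : fderiv ℝ R 0 ≠ 0)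
    (hLevi : ∀ᶠ z in 𝓝 0, R z = 0 → ∀ t, complexPart (fderiv ℝ R z) t = 0 → 0 ≤ leviForm R z t)
    {φ : ℂ → E} (hφ : AnalyticAt ℂ φ 0) (hφ0 : φ 0 = 0) {a : ℕ} (ha : a ≠ 0)
    (hr : ContDiffAt ℝ a (fun ζ => R (φ ζ)) 0)
    (hvan : ∀ j < a, iteratedFDeriv ℝ j (fun ζ => R (φ ζ)) 0 = 0) :
    ∃ C, ∀ᶠ ζ in 𝓝 0, -(C * ‖ζ‖ ^ (a - 1)) ≤ planeLaplacian (fun ζ => R (φ ζ)) ζ := by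
  obtain ⟨a, rfl⟩ := Nat.exists_eq_succ_of_ne_zero ha
  simp only [Nat.succ_eq_add_one, Nat.add_sub_cancel] at *
  obtain ⟨v, hv⟩ : ∃ v, fderiv ℝ R 0 v = 1 := by
    obtain ⟨u, hu⟩ : ∃ u, fderiv ℝ R 0 u ≠ 0 := by
      by_contra! h
      exact hdR (ContinuousLinearMap.ext h)
    exact ⟨(fderiv ℝ R 0 u)⁻¹ • u, by simp [hu]⟩
  set g : ℂ → ℝ := fun ζ => ‖ζ‖ ^ a with hg
  have hg1 : g =O[𝓝 0] fun _ => (1 : ℝ) := by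
    have : Continuous g := by fun_prop
    exact this.continuousAt.tendsto.isBigO_one ℝ
  have hφt : Tendsto φ (𝓝 0) (𝓝 0) := by
    simpa [hφ0] using hφ.continuousAt.tendsto
  -- the parameters of the projection onto the hypersurface
  obtain ⟨s, hs⟩ := (hφt.eventually
    (eventually_exists_root_on_line (hR.of_le (by norm_num)) hR0 hv)).choice
  set w : ℂ → E := fun ζ => φ ζ + s ζ • v with hw
  set t : ℂ → E := deriv φ with ht
  set c : ℂ → ℂ := fun ζ =>
    complexPart (fderiv ℝ R (w ζ)) (t ζ) / complexPart (fderiv ℝ R (w ζ)) v with hc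
  have hrO := isBigO_norm_pow_of_iteratedFDeriv_eq_zero hr hvan
  have hsr : s =O[𝓝 0] fun ζ => R (φ ζ) :=
    IsBigO.of_bound 2 (hs.mono fun ζ hζ => hζ.1)
  have hsO : s =O[𝓝 0] g := by
    refine (hsr.trans hrO).trans ?_
    have : (fun ζ : ℂ => ‖ζ‖) =O[𝓝 0] fun _ => (1 : ℝ) :=
      (continuous_norm.tendsto (0 : ℂ)).isBigO_one ℝ
    simpa [pow_succ] using (isBigO_refl g (𝓝 0)).mul this
  have hst : Tendsto s (𝓝 0) (𝓝 0) := by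
    refine hsr.trans_tendsto ?_
    have : ContinuousAt (fun ζ => R (φ ζ)) 0 := hr.continuousAt
    simpa [hφ0, hR0] using this.tendsto
  have hwt : Tendsto w (𝓝 0) (𝓝 0) := by
    simpa using hφt.add (hst.smul_const v)
  have hwφ : (fun ζ => w ζ - φ ζ) =O[𝓝 0] g := by
    refine IsBigO.trans ?_ hsO
    refine IsBigO.of_bound ‖v‖ (.of_forall fun ζ => ?_)
    simp [hw, norm_smul, mul_comm]
  have ht1 : t =O[𝓝 0] fun _ => (1 : ℝ) := hφ.deriv.continuousAt.tendsto.isBigO_one ℝ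
  have hv1 : (fun _ : ℂ => v) =O[𝓝 0] fun _ => (1 : ℝ) := isBigO_const_const _ one_ne_zero _
  -- local Lipschitz estimates
  have hD : ContDiffAt ℝ 2 (fderiv ℝ R) 0 := hR.fderiv_right (by norm_num)
  have hD2 : ContDiffAt ℝ 1 (fderiv ℝ (fderiv ℝ R)) 0 := hD.fderiv_right (by norm_num)
  have hpair : Tendsto (fun ζ => (w ζ, φ ζ)) (𝓝 0) (𝓝 ((0 : E), (0 : E))) := by
    rw [nhds_prod_eq]; exact hwt.prodMk hφt
  have hDO : (fun ζ => fderiv ℝ R (w ζ) - fderiv ℝ R (φ ζ)) =O[𝓝 0] g :=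
    ((hD.hasStrictFDerivAt (by simp)).isBigO_sub.comp_tendsto hpair).trans hwφ
  have hBO : (fun ζ => fderiv ℝ (fderiv ℝ R) (w ζ) - fderiv ℝ (fderiv ℝ R) (φ ζ)) =O[𝓝 0] g :=
    ((hD2.hasStrictFDerivAt (by simp)).isBigO_sub.comp_tendsto hpair).trans hwφ
  have hB1 : (fun ζ => fderiv ℝ (fderiv ℝ R) (φ ζ)) =O[𝓝 0] fun _ => (1 : ℝ) :=
    (hD2.continuousAt.tendsto.comp hφt).isBigO_one ℝ
  have hφev : ∀ᶠ ζ in 𝓝 0, AnalyticAt ℂ φ ζ := hφ.eventually_analyticAt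
  have hRev : ∀ᶠ ζ in 𝓝 0, ContDiffAt ℝ 3 R (φ ζ) := hφt.eventually (hR.eventually (by simp))
  have hdr : fderiv ℝ (fun ζ => R (φ ζ)) =O[𝓝 0] g :=
    isBigO_norm_pow_of_iteratedFDeriv_eq_zero (hr.fderiv_right (by norm_cast)) fun j hj =>
      iteratedFDeriv_fderiv_eq_zero_iff.2 (hvan (j + 1) (by omega))
  have hnum0 : (fun ζ => complexPart (fderiv ℝ R (φ ζ)) (t ζ)) =O[𝓝 0] g := by
    refine IsBigO.trans (IsBigO.of_bound 2 ?_) hdr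
    filter_upwards [hφev, hRev] with ζ h1 h2
    have hk : ∀ u : ℂ, ‖u‖ = 1 → |fderiv ℝ R (φ ζ) (u • t ζ)| ≤
        ‖fderiv ℝ (fun ζ => R (φ ζ)) ζ‖ := by
      intro u hu
      rw [← fderiv_comp_holomorphic (h2.differentiableAt (by simp)) h1.differentiableAt]
      simpa [hu] using (fderiv ℝ (fun ζ => R (φ ζ)) ζ).le_opNorm u
    have hk1 := hk 1 (by simp)
    rw [one_smul] at hk1
    linarith [norm_complexPart_le (fderiv ℝ R (φ ζ)) (t ζ), hk Complex.I (by simp)]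
  have hnum : (fun ζ => complexPart (fderiv ℝ R (w ζ)) (t ζ)) =O[𝓝 0] g := by
    have := isBigO_complexPart hDO ht1
    simp only [mul_one] at this
    refine (this.add hnum0).congr_left fun ζ => ?_
    apply Complex.ext <;> simp [complexPart]
    ring
  have hden : Tendsto (fun ζ => complexPart (fderiv ℝ R (w ζ)) v) (𝓝 0)
      (𝓝 (complexPart (fderiv ℝ R 0) v)) := by
    have h1 := hD.continuousAt.tendsto.comp hwt
    have h2 : Continuous fun L : E →L[ℝ] ℝ => complexPart L v := by
      have : (fun L : E →L[ℝ] ℝ => complexPart L v) =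
          fun L => ((L v : ℝ) : ℂ) - ((L (Complex.I • v) : ℝ) : ℂ) * Complex.I := by
        ext L
        apply Complex.ext <;> simp [complexPart]
      rw [this]
      fun_prop
    exact (h2.tendsto _).comp h1
  have hden0 : complexPart (fderiv ℝ R 0) v ≠ 0 := fun h => by
    simpa [complexPart, hv] using congrArg Complex.re h
  have hcO : c =O[𝓝 0] g := by
    have := hnum.mul ((hden.inv₀ hden0).isBigO_one ℝ)
    simpa [hc, div_eq_mul_inv] using this
  have hcv : (fun ζ => c ζ • v) =O[𝓝 0] g := by
    simpa using hcO.smul hv1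
  have ht' : (fun ζ => t ζ - c ζ • v) =O[𝓝 0] fun _ => (1 : ℝ) := ht1.sub (hcv.trans hg1)
  have htt : (fun ζ => t ζ - c ζ • v - t ζ) =O[𝓝 0] g :=
    hcv.neg_left.congr_left fun ζ => by abel
  obtain ⟨C, hC⟩ := (isBigO_leviForm_sub hBO hB1 ht1 ht' htt).bound
  refine ⟨C, ?_⟩
  filter_upwards [hC, hs, hwt.eventually hLevi, hφev, hRev,
    hden.eventually (isOpen_ne.mem_nhds hden0)] with ζ h1 h2 h3 h4 h5 h6
  have h7 := h3 h2.2 (t ζ - c ζ • v) (by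
    rw [complexPart_sub_smul, hc, div_mul_cancel₀ _ h6, sub_self])
  rw [planeLaplacian_comp_holomorphic (h5.of_le (by norm_num)) h4]
  rw [Real.norm_eq_abs, Real.norm_of_nonneg (show 0 ≤ g ζ by positivity), abs_le] at h1
  linarith [h1.2]

end LeviForm

section Wirtinger

theorem Pi.eq_sum_smul_single {d : ℕ} (t : Fin d → ℂ) :
    t = ∑ j, t j • (Pi.single j 1 : Fin d → ℂ) := by
  ext i
  simp [Finset.sum_apply, Pi.single_apply]

theorem I_smul_single {d : ℕ} (j : Fin d) :
    Complex.I • (Pi.single j 1 : Fin d → ℂ) = Pi.single j Complex.I := by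
  ext i
  simp [Pi.single_apply]

section Sesquilinear

universe v

variable {E : Type v} [NormedAddCommGroup E] [NormedSpace ℂ E]

theorem complexPart_sum_smul (L : E →L[ℝ] ℝ) {ι : Type*} (s : Finset ι) (c : ι → ℂ) (e : ι → E) :
    complexPart L (∑ j ∈ s, c j • e j) = ∑ j ∈ s, c j * complexPart L (e j) := by
  induction s using Finset.cons_induction with
  | empty => apply Complex.ext <;> simp [complexPart]
  | cons j s hj ih =>
    rw [Finset.sum_cons, Finset.sum_cons, ← ih, add_comm, ← sub_neg_eq_add, ← neg_smul,
      complexPart_sub_smul]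
    ring

/-- The sesquilinear form whose diagonal has real part `B t t + B (i t) (i t)`. -/
noncomputable def sesqForm (B : E →L[ℝ] E →L[ℝ] ℝ) (x y : E) : ℂ :=
  complexPart (B.flip y) x + Complex.I * complexPart (B.flip (Complex.I • y)) x

theorem sesqForm_eq_conj (B : E →L[ℝ] E →L[ℝ] ℝ) (x y : E) :
    sesqForm B x y = (starRingEnd ℂ) (complexPart (B x) y) -
      Complex.I * (starRingEnd ℂ) (complexPart (B (Complex.I • x)) y) := by
  apply Complex.ext <;> simp [sesqForm, complexPart]
  ring

theorem sesqForm_sum_smul (B : E →L[ℝ] E →L[ℝ] ℝ) {ι : Type*} (s : Finset ι) (c : ι → ℂ)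
    (e : ι → E) :
    sesqForm B (∑ j ∈ s, c j • e j) (∑ j ∈ s, c j • e j) =
      ∑ j ∈ s, ∑ k ∈ s, sesqForm B (e j) (e k) * c j * (starRingEnd ℂ) (c k) := by
  have h1 : ∀ y, sesqForm B (∑ j ∈ s, c j • e j) y = ∑ j ∈ s, c j * sesqForm B (e j) y := by
    intro y
    simp only [sesqForm, complexPart_sum_smul, Finset.mul_sum, ← Finset.sum_add_distrib]
    exact Finset.sum_congr rfl fun j _ => by ring
  rw [h1]
  refine Finset.sum_congr rfl fun j _ => ?_
  simp only [sesqForm_eq_conj, complexPart_sum_smul, map_sum, map_mul, Finset.mul_sum,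
    ← Finset.sum_sub_distrib]
  exact Finset.sum_congr rfl fun k _ => by ring

end Sesquilinear

variable {d : ℕ} {R : (Fin d → ℂ) → ℝ} {z : Fin d → ℂ}

theorem fderiv_ofReal_comp (hR : DifferentiableAt ℝ R z) (u : Fin d → ℂ) :
    fderiv ℝ (fun w => (R w : ℂ)) z u = (fderiv ℝ R z u : ℂ) := by
  have h : HasFDerivAt (fun w => (R w : ℂ)) (Complex.ofRealCLM.comp (fderiv ℝ R z)) z :=
    Complex.ofRealCLM.hasFDerivAt.comp z hR.hasFDerivAt
  rw [h.fderiv]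
  rfl

theorem wd_ofReal (hR : DifferentiableAt ℝ R z) (j : Fin d) :
    wd j (fun w => (R w : ℂ)) z = complexPart (fderiv ℝ R z) (Pi.single j 1) / 2 := by
  rw [wd, fderiv_ofReal_comp hR, fderiv_ofReal_comp hR]
  congr 1
  apply Complex.ext <;> simp [complexPart, I_smul_single]

theorem wdbar_ofReal (hR : DifferentiableAt ℝ R z) (j : Fin d) :
    wdbar j (fun w => (R w : ℂ)) z =
      (starRingEnd ℂ) (complexPart (fderiv ℝ R z) (Pi.single j 1)) / 2 := by
  rw [wdbar, fderiv_ofReal_comp hR, fderiv_ofReal_comp hR]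
  congr 1
  apply Complex.ext <;> simp [complexPart, I_smul_single]

theorem dpair_ofReal (hR : DifferentiableAt ℝ R z) (t : Fin d → ℂ) :
    dpair (fun w => (R w : ℂ)) z t = complexPart (fderiv ℝ R z) t / 2 := by
  conv_rhs => rw [Pi.eq_sum_smul_single t, complexPart_sum_smul, Finset.sum_div]
  rw [dpair]
  refine Finset.sum_congr rfl fun j _ => ?_
  rw [wd_ofReal hR]
  ring

theorem wd_wdbar_ofReal (hR : ContDiffAt ℝ 2 R z) (j k : Fin d) :
    wd j (fun w => wdbar k (fun w => (R w : ℂ)) w) z =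
      sesqForm (fderiv ℝ (fderiv ℝ R) z) (Pi.single j 1) (Pi.single k 1) / 4 := by
  have hd2 : DifferentiableAt ℝ (fderiv ℝ R) z :=
    (hR.fderiv_right (m := 1) (by norm_num)).differentiableAt (by simp)
  have h1 : (fun w => wdbar k (fun w => (R w : ℂ)) w) =ᶠ[𝓝 z] fun w =>
      (2⁻¹ : ℂ) * (((fderiv ℝ R w (Pi.single k 1) : ℝ) : ℂ) +
        Complex.I * ((fderiv ℝ R w (Pi.single k Complex.I) : ℝ) : ℂ)) := by
    filter_upwards [hR.eventually (by simp)] with w hw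
    have := hw.differentiableAt (by simp)
    rw [wdbar, fderiv_ofReal_comp this, fderiv_ofReal_comp this]
    ring
  have h2 : ∀ e : Fin d → ℂ, HasFDerivAt (fun w => ((fderiv ℝ R w e : ℝ) : ℂ))
      (Complex.ofRealCLM.comp ((fderiv ℝ (fderiv ℝ R) z).flip e)) z := by
    intro e
    refine Complex.ofRealCLM.hasFDerivAt.comp z
      ((hd2.hasFDerivAt.clm_apply (hasFDerivAt_const e z)).congr_fderiv ?_)
    ext u; simp
  have h3 := (((h2 (Pi.single k 1)).add ((h2 (Pi.single k Complex.I)).const_mul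
    Complex.I)).const_mul (2⁻¹ : ℂ)).congr_of_eventuallyEq h1
  rw [wd, h3.fderiv, sesqForm_eq_conj]
  apply Complex.ext <;> simp [complexPart, I_smul_single] <;> ring

theorem hessForm_ofReal (hR : ContDiffAt ℝ 2 R z) (t : Fin d → ℂ) :
    hessForm (fun w => (R w : ℂ)) z t = leviForm R z t / 4 := by
  have h1 : leviForm R z t = (sesqForm (fderiv ℝ (fderiv ℝ R) z) t t).re := by
    simp [leviForm, sesqForm, complexPart]
  rw [h1]
  conv_rhs => rw [Pi.eq_sum_smul_single t, sesqForm_sum_smul]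
  rw [hessForm, ← Complex.div_ofNat_re, Finset.sum_div]
  congr 1
  refine Finset.sum_congr rfl fun j _ => ?_
  rw [Finset.sum_div]
  refine Finset.sum_congr rfl fun k _ => ?_
  rw [wd_wdbar_ofReal hR]
  ring

end Wirtinger

section VanishesTo

universe u v

variable {E : Type u} {F : Type v} [NormedAddCommGroup E] [NormedSpace ℝ E]
  [NormedAddCommGroup F] [NormedSpace ℝ F] {f g : ℂ → E} {a b : ℕ}

theorem vanishesTo.eq (ha : vanishesTo f a) (hb : vanishesTo f b) : a = b := by
  rcases lt_trichotomy a b with h | h | h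
  · exact absurd (hb.1 a h) ha.2
  · exact h
  · exact absurd (ha.1 b h) hb.2

theorem vanishesTo.congr (ha : vanishesTo f a) (h : f =ᶠ[𝓝 0] g) : vanishesTo g a := by
  have h' : ∀ j, iteratedFDeriv ℝ j g 0 = iteratedFDeriv ℝ j f 0 := fun j =>
    (h.symm.iteratedFDeriv ℝ j).self_of_nhds
  exact ⟨fun j hj => (h' j).trans (ha.1 j hj), fun h0 => ha.2 ((h' a).symm.trans h0)⟩

theorem vanishesTo.ne_zero (ha : vanishesTo f a) (hf : f 0 = 0) : a ≠ 0 := by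
  rintro rfl
  refine ha.2 (ContinuousMultilinearMap.ext fun v => ?_)
  simpa using hf

theorem vanishesTo.add_of_lt (hf : ContDiffAt ℝ ∞ f 0) (hg : ContDiffAt ℝ ∞ g 0)
    (ha : vanishesTo f a) (hb : vanishesTo g b) (hab : a < b) :
    vanishesTo (fun ζ => f ζ + g ζ) a := by
  have h : ∀ j ≤ a, iteratedFDeriv ℝ j (fun ζ => f ζ + g ζ) 0 = iteratedFDeriv ℝ j f 0 := by
    intro j hj
    rw [fun_iteratedFDeriv_add_apply (hf.of_le (by exact_mod_cast le_top))
      (hg.of_le (by exact_mod_cast le_top)), hb.1 j (by omega), add_zero]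
  exact ⟨fun j hj => (h j hj.le).trans (ha.1 j hj), fun h0 => ha.2 ((h a le_rfl).symm.trans h0)⟩

theorem iteratedFDeriv_clm_comp_eq_zero_iff {L : E →L[ℝ] F} (hL : Function.Injective L)
    (hf : ContDiffAt ℝ ∞ f 0) (j : ℕ) :
    iteratedFDeriv ℝ j (fun ζ => L (f ζ)) 0 = 0 ↔ iteratedFDeriv ℝ j f 0 = 0 := by
  have := L.iteratedFDeriv_comp_left hf (i := j) (by exact_mod_cast le_top)
  rw [show (fun ζ => L (f ζ)) = L ∘ f from rfl, this]
  constructor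
  · intro h
    ext v
    exact hL (by simpa using congrArg (fun M => M v) h)
  · intro h
    rw [h]
    ext v
    simp

theorem vanishesTo_clm_comp_iff {L : E →L[ℝ] F} (hL : Function.Injective L)
    (hf : ContDiffAt ℝ ∞ f 0) : vanishesTo (fun ζ => L (f ζ)) a ↔ vanishesTo f a := by
  simp only [vanishesTo, ne_eq, iteratedFDeriv_clm_comp_eq_zero_iff hL hf]

theorem vanishesTo_ofReal_iff {f : ℂ → ℝ} (hf : ContDiffAt ℝ ∞ f 0) :
    vanishesTo (fun ζ => (f ζ : ℂ)) a ↔ vanishesTo f a :=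
  vanishesTo_clm_comp_iff (L := Complex.ofRealCLM) Complex.ofReal_injective hf

theorem iteratedFDeriv_prod_eq_zero_iff {f : ℂ → E × F} (hf : ContDiffAt ℝ ∞ f 0) (j : ℕ) :
    iteratedFDeriv ℝ j f 0 = 0 ↔ iteratedFDeriv ℝ j (fun ζ => (f ζ).1) 0 = 0 ∧
      iteratedFDeriv ℝ j (fun ζ => (f ζ).2) 0 = 0 := by
  have h1 := (ContinuousLinearMap.fst ℝ E F).iteratedFDeriv_comp_left hf (i := j)
    (by exact_mod_cast le_top)
  have h2 := (ContinuousLinearMap.snd ℝ E F).iteratedFDeriv_comp_left hf (i := j)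
    (by exact_mod_cast le_top)
  rw [show (fun ζ => (f ζ).1) = ContinuousLinearMap.fst ℝ E F ∘ f from rfl,
    show (fun ζ => (f ζ).2) = ContinuousLinearMap.snd ℝ E F ∘ f from rfl, h1, h2]
  constructor
  · intro h
    rw [h]
    constructor <;> ext v <;> simp
  · rintro ⟨h, h'⟩
    ext v
    · simpa using congrArg (fun M => M v) h
    · simpa using congrArg (fun M => M v) h'

theorem vanishesTo_or_eventually_eq_zero {E : Type u} [NormedAddCommGroup E] [NormedSpace ℂ E]
    [CompleteSpace E] {φ : ℂ → E} (hφ : AnalyticAt ℂ φ 0) :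
    (∃ b, vanishesTo φ b) ∨ ∀ᶠ ζ in 𝓝 0, φ ζ = 0 := by
  by_cases h : ∃ b, iteratedFDeriv ℝ b φ 0 ≠ 0
  · classical
    exact .inl ⟨Nat.find h, fun j hj => not_not.1 (Nat.find_min h hj), Nat.find_spec h⟩
  · push Not at h
    right
    obtain ⟨p, r, hp⟩ := hφ.restrictScalars (𝕜 := ℝ)
    filter_upwards [Metric.eball_mem_nhds (0 : ℂ) hp.r_pos] with ζ hζ
    have := hp.hasSum_iteratedFDeriv hζ
    simp only [h, zero_apply, smul_zero, zero_add] at this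
    exact this.unique hasSum_zero

end VanishesTo

section FiniteType

theorem analyticAt_of_disc {E : Type*} [NormedAddCommGroup E] [NormedSpace ℂ E] [CompleteSpace E]
    {φ : ℂ → E} (hφ : DifferentiableOn ℂ φ (Metric.ball 0 1)) : AnalyticAt ℂ φ 0 :=
  hφ.analyticAt (Metric.ball_mem_nhds _ one_pos)

theorem ContDiffOn.contDiffAt_comp_disc {E : Type*} [NormedAddCommGroup E] [NormedSpace ℂ E]
    {R : E → ℝ} {U : Set E} (hR : ContDiffOn ℝ ∞ R U) (hU : U ∈ 𝓝 0) {φ : ℂ → E}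
    [CompleteSpace E] (hφ : AnalyticAt ℂ φ 0) (hφ0 : φ 0 = 0) :
    ContDiffAt ℝ ∞ (fun ζ => R (φ ζ)) 0 :=
  ContDiffAt.comp (0 : ℂ) (g := R) (hφ0.symm ▸ hR.contDiffAt hU)
    (hφ.contDiffAt.restrict_scalars ℝ)

theorem vanishesTo_add_min {f g : ℂ → ℝ} (hf : ContDiffAt ℝ ∞ f 0)
    (hg : ContDiffAt ℝ ∞ g 0) (hf0 : f 0 = 0)
    (hlap : ∀ a ≠ 0, (∀ j < a, iteratedFDeriv ℝ j f 0 = 0) →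
      ∃ C, ∀ᶠ ζ in 𝓝 0, -(C * ‖ζ‖ ^ (a - 1)) ≤ planeLaplacian f ζ)
    (hnn : ∀ᶠ ζ in 𝓝 0, 0 ≤ g ζ) {a b : ℕ} (ha : vanishesTo f a) (hb : vanishesTo g b) :
    vanishesTo (fun ζ => f ζ + g ζ) (min a b) := by
  rcases lt_trichotomy a b with h | rfl | h
  · rw [min_eq_left h.le]
    exact ha.add_of_lt hf hg hb h
  · obtain ⟨C, hC⟩ := hlap a (ha.ne_zero hf0) ha.1
    rw [min_self]
    refine ⟨fun j hj => ?_, iteratedFDeriv_add_ne_zero (ha.ne_zero hf0)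
      (hf.of_le (by exact_mod_cast le_top)) (hg.of_le (by exact_mod_cast le_top)) ha.1 hb.1 hC
      hnn hb.2⟩
    rw [fun_iteratedFDeriv_add_apply (hf.of_le (by exact_mod_cast le_top))
      (hg.of_le (by exact_mod_cast le_top)), ha.1 j hj, hb.1 j hj, add_zero]
  · rw [min_eq_right h.le]
    simpa only [add_comm] using hb.add_of_lt hg hf ha h

/-- A disc in a hypersurface of finite type is either constant near the origin or has the order
of contact bounded by the type. -/
theorem IsFiniteTypeAt.exists_vanishesTo {E : Type*} [NormedAddCommGroup E] [NormedSpace ℂ E]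
    {f : E → ℂ} {U : Set E} {τ : ℝ} (hf : IsFiniteTypeAt f U 0 τ) {φ : ℂ → E}
    (hφ : DifferentiableOn ℂ φ (Metric.ball 0 1)) (hU : Set.MapsTo φ (Metric.ball 0 1) U)
    (hφ0 : φ 0 = 0) {b : ℕ} (hb : vanishesTo φ b) :
    ∃ a, vanishesTo (fun ζ => f (φ ζ)) a ∧ (a : ℝ) / b ≤ τ := by
  have hb' : vanishesTo (fun ζ => φ ζ - 0) b := by simpa using hb
  have hb0 : 0 < b := Nat.pos_of_ne_zero (hb.ne_zero hφ0)
  obtain ⟨a, ha⟩ := hf.1 φ hφ hU hφ0 ⟨b, hb0, hb'⟩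
  exact ⟨a, ha, hf.2.1 ⟨φ, a, b, hφ, hU, hφ0, hb0, hb', ha, rfl⟩⟩

theorem exists_vanishesTo_add_of_disc {n m : ℕ} {U : Set (Fin n → ℂ)} {V : Set (Fin m → ℂ)}
    (hU : U ∈ 𝓝 0) (hV : V ∈ 𝓝 0) {R : (Fin n → ℂ) → ℝ} {H : (Fin m → ℂ) → ℝ}
    (hR : ContDiffOn ℝ ∞ R U) (hH : ContDiffOn ℝ ∞ H V) (hR0 : R 0 = 0) (hH0 : H 0 = 0)
    (hdR : fderiv ℝ R 0 ≠ 0)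
    (hLevi : ∀ᶠ z in 𝓝 0, R z = 0 → ∀ t, complexPart (fderiv ℝ R z) t = 0 → 0 ≤ leviForm R z t)
    (hHnonneg : ∀ w ∈ V, 0 ≤ H w) {τ σ : ℝ}
    (hτ : IsFiniteTypeAt (fun z => (R z : ℂ)) U 0 τ)
    (hσ : IsFiniteTypeAt (fun w => (H w : ℂ)) V 0 σ)
    {Φ : ℂ → (Fin n → ℂ) × (Fin m → ℂ)} (hΦ : DifferentiableOn ℂ Φ (Metric.ball 0 1))
    (hmaps : Set.MapsTo Φ (Metric.ball 0 1) (U ×ˢ V)) (hΦ0 : Φ 0 = 0) {b : ℕ}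
    (hb : vanishesTo Φ b) :
    ∃ a, vanishesTo (fun ζ => (R (Φ ζ).1 : ℂ) + (H (Φ ζ).2 : ℂ)) a ∧ (a : ℝ) / b ≤ max τ σ := by
  have hφd : DifferentiableOn ℂ (fun ζ => (Φ ζ).1) (Metric.ball 0 1) := hΦ.fst
  have hψd : DifferentiableOn ℂ (fun ζ => (Φ ζ).2) (Metric.ball 0 1) := hΦ.snd
  have hφU : Set.MapsTo (fun ζ => (Φ ζ).1) (Metric.ball 0 1) U := fun ζ hζ => (hmaps hζ).1
  have hψV : Set.MapsTo (fun ζ => (Φ ζ).2) (Metric.ball 0 1) V := fun ζ hζ => (hmaps hζ).2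
  have hφ0 : (Φ 0).1 = 0 := by simp [hΦ0]
  have hψ0 : (Φ 0).2 = 0 := by simp [hΦ0]
  have hφa := analyticAt_of_disc hφd
  have hψa := analyticAt_of_disc hψd
  have hf : ContDiffAt ℝ ∞ (fun ζ => R (Φ ζ).1) 0 := hR.contDiffAt_comp_disc hU hφa hφ0
  have hg : ContDiffAt ℝ ∞ (fun ζ => H (Φ ζ).2) 0 := hH.contDiffAt_comp_disc hV hψa hψ0
  have hΦs : ContDiffAt ℝ ∞ Φ 0 := (analyticAt_of_disc hΦ).contDiffAt.restrict_scalars ℝ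
  have hsum : ∀ {a}, vanishesTo (fun ζ => R (Φ ζ).1 + H (Φ ζ).2) a →
      vanishesTo (fun ζ => (R (Φ ζ).1 : ℂ) + (H (Φ ζ).2 : ℂ)) a := fun ha => by
    simpa only [Complex.ofReal_add] using (vanishesTo_ofReal_iff (hf.add hg)).2 ha
  have hmin : ∀ {a a'}, vanishesTo (fun ζ => R (Φ ζ).1) a → vanishesTo (fun ζ => H (Φ ζ).2) a' →
      vanishesTo (fun ζ => R (Φ ζ).1 + H (Φ ζ).2) (min a a') := by
    refine vanishesTo_add_min hf hg (by simp [hφ0, hR0]) (fun a ha hvan => ?_) ?_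
    · exact exists_le_planeLaplacian_of_leviForm_nonneg
        ((hR.contDiffAt hU).of_le ENat.LEInfty.out) hR0 hdR hLevi hφa hφ0 ha
        (hf.of_le (by exact_mod_cast le_top)) hvan
    · filter_upwards [Metric.ball_mem_nhds (0 : ℂ) one_pos] with ζ hζ
      exact hHnonneg _ (hψV hζ)
  have hfτ : ∀ {b}, vanishesTo (fun ζ => (Φ ζ).1) b →
      ∃ a, vanishesTo (fun ζ => R (Φ ζ).1) a ∧ (a : ℝ) / b ≤ τ := fun hb => by
    obtain ⟨a, ha, hab⟩ := hτ.exists_vanishesTo hφd hφU hφ0 hb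
    exact ⟨a, (vanishesTo_ofReal_iff hf).1 ha, hab⟩
  have hgσ : ∀ {b}, vanishesTo (fun ζ => (Φ ζ).2) b →
      ∃ a, vanishesTo (fun ζ => H (Φ ζ).2) a ∧ (a : ℝ) / b ≤ σ := fun hb => by
    obtain ⟨a, ha, hab⟩ := hσ.exists_vanishesTo hψd hψV hψ0 hb
    exact ⟨a, (vanishesTo_ofReal_iff hg).1 ha, hab⟩
  have hle : ∀ {c d : ℕ} {x : ℝ}, c ≤ d → (d : ℝ) / b ≤ x → (c : ℝ) / b ≤ x := fun hcd hx =>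
    (div_le_div_of_nonneg_right (by exact_mod_cast hcd) (Nat.cast_nonneg b)).trans hx
  have hvan : ∀ j < b, iteratedFDeriv ℝ j (fun ζ => (Φ ζ).1) 0 = 0 ∧
      iteratedFDeriv ℝ j (fun ζ => (Φ ζ).2) 0 = 0 := fun j hj =>
    (iteratedFDeriv_prod_eq_zero_iff hΦs j).1 (hb.1 j hj)
  have hne := hb.2
  rw [Ne, iteratedFDeriv_prod_eq_zero_iff hΦs, not_and_or] at hne
  rcases hne with hne | hne
  · obtain ⟨a, ha, hab⟩ := hfτ ⟨fun j hj => (hvan j hj).1, hne⟩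
    rcases vanishesTo_or_eventually_eq_zero hψa with ⟨b', hb'⟩ | hzero
    · obtain ⟨a', ha', -⟩ := hgσ hb'
      exact ⟨_, hsum (hmin ha ha'), le_max_of_le_left (hle (min_le_left _ _) hab)⟩
    · refine ⟨a, hsum (ha.congr ?_), le_max_of_le_left hab⟩
      filter_upwards [hzero] with ζ hζ
      rw [hζ, hH0, add_zero]
  · obtain ⟨a, ha, hab⟩ := hgσ ⟨fun j hj => (hvan j hj).2, hne⟩
    rcases vanishesTo_or_eventually_eq_zero hφa with ⟨b', hb'⟩ | hzero
    · obtain ⟨a', ha', -⟩ := hfτ hb'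
      exact ⟨_, hsum (hmin ha' ha), le_max_of_le_right (hle (min_le_right _ _) hab)⟩
    · refine ⟨a, hsum (ha.congr ?_), le_max_of_le_right hab⟩
      filter_upwards [hzero] with ζ hζ
      rw [hζ, hR0, zero_add]

/-- Discs in `E` embed into `F`, so that the ratios for a restricted function are ratios for the
function itself. -/
theorem typeRatios_subset_of_clm {E F : Type*} [NormedAddCommGroup E] [NormedSpace ℂ E]
    [CompleteSpace E] [NormedAddCommGroup F] [NormedSpace ℂ F] {L : E →L[ℂ] F}
    (hL : Function.Injective L) {f : E → ℂ} {g : F → ℂ} {U : Set E} {W : Set F}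
    (hfg : ∀ x, g (L x) = f x) (hUW : Set.MapsTo L U W) :
    typeRatios f U 0 ⊆ typeRatios g W 0 := by
  rintro x ⟨φ, a, b, hφ, hmaps, hφ0, hb0, hb, ha, rfl⟩
  simp only [sub_zero] at hb
  refine ⟨fun ζ => L (φ ζ), a, b, L.differentiable.comp_differentiableOn hφ, hUW.comp hmaps,
    by simp [hφ0], hb0, ?_, by simpa only [hfg] using ha, rfl⟩
  simp only [sub_zero]
  exact (vanishesTo_clm_comp_iff (L := L.restrictScalars ℝ) hL
    ((analyticAt_of_disc hφ).contDiffAt.restrict_scalars ℝ)).2 hb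

end FiniteType

end DiscContact

/-- additivity of finite type for decoupled defining functions:
if {ρ = 0} has nonnegative Levi form on its complex tangent space and is of finite
type τ at 0, and h ≥ 0 (h = 0 only at 0, ∇h ≠ 0 off 0) is of finite type typ₀(h) at 0,
then {ρ(z)+h(w) = 0} is of finite type max(τ, typ₀(h)) at (0,0). -/
theorem stmt9 (n m : ℕ)
    (U : Set (Fin n → ℂ)) (hU : IsOpen U) (hU0 : (0 : Fin n → ℂ) ∈ U)
    (V : Set (Fin m → ℂ)) (hV : IsOpen V) (hV0 : (0 : Fin m → ℂ) ∈ V)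
    (ρ : (Fin n → ℂ) → ℂ) (h : (Fin m → ℂ) → ℂ)
    (hρsm : ContDiffOn ℝ (⊤ : ℕ∞) ρ U) (hhsm : ContDiffOn ℝ (⊤ : ℕ∞) h V)
    (hρreal : ∀ z, (ρ z).im = 0) (hhreal : ∀ w, (h w).im = 0)
    (hρ0 : ρ 0 = 0)
    (hρgrad : ∀ z ∈ U, fderiv ℝ ρ z ≠ 0)
    (hLevi : ∀ z ∈ U, ρ z = 0 → ∀ t : Fin n → ℂ, dpair ρ z t = 0 → 0 ≤ hessForm ρ z t)
    (hhnonneg : ∀ w ∈ V, 0 ≤ (h w).re)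
    (hhzero : ∀ w ∈ V, (h w = 0 ↔ w = 0))
    (hhgrad : ∀ w ∈ V, w ≠ 0 → fderiv ℝ h w ≠ 0)
    (τ σ : ℝ)
    (hτ : IsFiniteTypeAt ρ U 0 τ)
    (hσ : IsFiniteTypeAt h V 0 σ) :
    IsFiniteTypeAt (fun p : (Fin n → ℂ) × (Fin m → ℂ) => ρ p.1 + h p.2)
      (U ×ˢ V) (0, 0) (max τ σ) := by
  have h0 : h 0 = 0 := (hhzero 0 hV0).2 rfl
  obtain ⟨R, rfl⟩ : ∃ R : (Fin n → ℂ) → ℝ, ρ = fun z => (R z : ℂ) :=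
    ⟨fun z => (ρ z).re, funext fun z => Complex.ext (by simp) (by simp [hρreal])⟩
  obtain ⟨H, rfl⟩ : ∃ H : (Fin m → ℂ) → ℝ, h = fun w => (H w : ℂ) :=
    ⟨fun w => (h w).re, funext fun w => Complex.ext (by simp) (by simp [hhreal])⟩
  have hUn := hU.mem_nhds hU0
  have hR : ContDiffOn ℝ (⊤ : ℕ∞) R U := Complex.reCLM.contDiff.comp_contDiffOn hρsm
  have hH : ContDiffOn ℝ (⊤ : ℕ∞) H V := Complex.reCLM.contDiff.comp_contDiffOn hhsm
  have hR0 : R 0 = 0 := by simpa using hρ0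
  have hH0 : H 0 = 0 := by simpa using h0
  have hR2 : ∀ z ∈ U, ContDiffAt ℝ 2 R z := fun z hz =>
    (hR.contDiffAt (hU.mem_nhds hz)).of_le ENat.LEInfty.out
  have hdR : fderiv ℝ R 0 ≠ 0 := by
    intro hz
    refine hρgrad 0 hU0 (ContinuousLinearMap.ext fun u => ?_)
    rw [fderiv_ofReal_comp ((hR2 0 hU0).differentiableAt (by simp)), hz]
    simp
  have hLevi' : ∀ᶠ z in nhds 0, R z = 0 → ∀ t, complexPart (fderiv ℝ R z) t = 0 →
      0 ≤ leviForm R z t := by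
    filter_upwards [hUn] with z hz hRz t ht
    have := hLevi z hz (by simp [hRz]) t (by
      rw [dpair_ofReal ((hR2 z hz).differentiableAt (by simp)), ht, zero_div])
    rw [hessForm_ofReal (hR2 z hz)] at this
    linarith
  have key := fun {Φ} hΦ hmaps hΦ0 {b} hb =>
    exists_vanishesTo_add_of_disc hUn (hV.mem_nhds hV0) hR hH hR0 hH0 hdR hLevi'
      (fun w hw => by simpa using hhnonneg w hw) hτ hσ (Φ := Φ) hΦ hmaps hΦ0 (b := b) hb
  refine ⟨fun Φ hΦ hmaps hΦ0 ⟨b, _, hb⟩ => ?_, ?_, fun B hB => max_le ?_ ?_⟩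
  · obtain ⟨a, ha, -⟩ := key hΦ hmaps hΦ0 (by simpa [← Prod.zero_eq_mk] using hb)
    exact ⟨a, ha⟩
  · rintro x ⟨Φ, a, b, hΦ, hmaps, hΦ0, _, hb, ha, rfl⟩
    obtain ⟨a', ha', hle⟩ := key hΦ hmaps hΦ0 (by simpa [← Prod.zero_eq_mk] using hb)
    rwa [ha.eq ha']
  · refine hτ.2.2 fun x hx => hB ?_
    refine typeRatios_subset_of_clm (L := ContinuousLinearMap.inl ℂ _ _)
      (LinearMap.inl_injective (R := ℂ)) ?_ ?_ hx
    · intro x; simp [hH0]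
    · intro x hx'; exact ⟨hx', hV0⟩
  · refine hσ.2.2 fun x hx => hB ?_
    refine typeRatios_subset_of_clm (L := ContinuousLinearMap.inr ℂ _ _)
      (LinearMap.inr_injective (R := ℂ)) ?_ ?_ hx
    · intro x; simp [hR0]
    · intro x hx'; exact ⟨hU0, hx'⟩
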